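/- Let t : ℤ → ℝ be a nondecreasing knot sequence, let B_{j,4} denote the order-4 B-spline basis functions for t, let α : ℤ → ℝ be zero for all but finitely many indices, and let 1 ≤ n. Then Σⱼ αⱼ B_{j,4}(x) ≥ 0 for all x ∈ [t₁, t_{n+1}) if and only if for every i ∈ {1, …, n} with tᵢ < t_{i+1} there exist real numbers c₁₁⁽ⁱ⁾, c₁₂⁽ⁱ⁾, c₂₂⁽ⁱ⁾, d₁₁⁽ⁱ⁾, d₁₂⁽ⁱ⁾, d₂₂⁽ⁱ⁾ with c₁₁⁽ⁱ⁾ ≥ 0, c₂₂⁽ⁱ⁾ ≥ 0, d₁₁⁽ⁱ⁾ ≥ 0, d₂₂⁽ⁱ⁾ ≥ 0, (c₁₂⁽ⁱ⁾)² ≤ c₁₁⁽ⁱ⁾c₂₂⁽ⁱ⁾, (d₁₂⁽ⁱ⁾)² ≤ d₁₁⁽ⁱ⁾d₂₂⁽ⁱ⁾, such that for all x ∈ [tᵢ, t_{i+1}): Σⱼ αⱼ B_{j,4}(x) = (x − tᵢ)(c₁₁⁽ⁱ⁾x² + 2c₁₂⁽ⁱ⁾x + c₂₂⁽ⁱ⁾)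 + (t_{i+1} − x)(d₁₁⁽ⁱ⁾x² + 2d₁₂⁽ⁱ⁾x + d₂₂⁽ⁱ⁾). -/

import Mathlib

/-- `bomega t i k x = (x − tᵢ)/(t_{i+k−1} − tᵢ)` if `tᵢ ≠ t_{i+k−1}`, and `0` otherwise. -/
noncomputable def bomega (t : ℤ → ℝ) (i : ℤ) (k : ℕ) (x : ℝ) : ℝ :=
  if t i ≠ t (i + (k : ℤ) - 1) then (x - t i) / (t (i + (k : ℤ) - 1) - t i) else 0

/-- The order-`k` B-spline basis functions for the knot sequence `t`:
`B_{i,1}` is the characteristic function of `[tᵢ, t_{i+1})`, and for `k > 1`,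
`B_{i,k} = ω_{i,k}·B_{i,k−1} + (1 − ω_{i+1,k})·B_{i+1,k−1}`.  (Order `0` is set to `0`.) -/
noncomputable def Bspline (t : ℤ → ℝ) : ℕ → ℤ → ℝ → ℝ
  | 0, _, _ => 0
  | 1, i, x => if t i ≤ x ∧ x < t (i + 1) then 1 else 0
  | (k + 2), i, x =>
      bomega t i (k + 2) x * Bspline t (k + 1) i x
        + (1 - bomega t (i + 1) (k + 2) x) * Bspline t (k + 1) (i + 1) x

open Polynomial in
/-- On a knot interval, a B-spline of order `k + 1` is a polynomial of degree at most `k`. -/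
theorem Bspline_eqOn_polynomial {t : ℤ → ℝ} (ht : Monotone t) (i : ℤ) (k : ℕ) (j : ℤ) :
    ∃ p : ℝ[X], p.natDegree ≤ k ∧
      ∀ x ∈ Set.Ico (t i) (t (i + 1)), Bspline t (k + 1) j x = p.eval x := by
  induction k generalizing j with
  | zero =>
    rcases lt_trichotomy j i with h | rfl | h
    · refine ⟨0, by simp, fun x hx => ?_⟩
      have := ht (show j + 1 ≤ i by lia)
      simp only [Bspline, eval_zero, ite_eq_right_iff]
      intro h'
      linarith [hx.1, h'.2]
    · refine ⟨1, by simp, fun x hx => ?_⟩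
      simp [Bspline, hx.1, hx.2]
    · refine ⟨0, by simp, fun x hx => ?_⟩
      have := ht (show i + 1 ≤ j by lia)
      simp only [Bspline, eval_zero, ite_eq_right_iff]
      intro h'
      linarith [hx.2, h'.1]
  | succ k ih =>
    have bomega_poly : ∀ j : ℤ, ∃ w : ℝ[X], w.natDegree ≤ 1 ∧
        ∀ x, bomega t j (k + 2) x = w.eval x := by
      intro j
      by_cases h : t j ≠ t (j + ((k + 2 : ℕ) : ℤ) - 1)
      · refine ⟨C (t (j + ((k + 2 : ℕ) : ℤ) - 1) - t j)⁻¹ * (X - C (t j)), ?_, fun x => ?_⟩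
        · compute_degree
        · rw [bomega, if_pos h]
          simp [div_eq_inv_mul]
      · exact ⟨0, by simp, fun x => by rw [bomega, if_neg h, eval_zero]⟩
    obtain ⟨p, hp, hp'⟩ := ih j
    obtain ⟨q, hq, hq'⟩ := ih (j + 1)
    obtain ⟨v, hv, hv'⟩ := bomega_poly j
    obtain ⟨w, hw, hw'⟩ := bomega_poly (j + 1)
    refine ⟨v * p + (1 - w) * q, ?_, fun x hx => ?_⟩
    · have h1w : (1 - w).natDegree ≤ 1 :=
        (natDegree_sub_le _ _).trans (by simpa using hw)
      refine (natDegree_add_le _ _).trans (max_le ?_ ?_)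
      · exact natDegree_mul_le.trans (by lia)
      · exact natDegree_mul_le.trans (by lia)
    · simp [Bspline, hp' x hx, hq' x hx, hv', hw']

/-- A finite combination of B-splines of order `k + 1` is a polynomial of degree at most `k` on
each knot interval. -/
theorem finsum_mul_Bspline_eqOn_polynomial {t : ℤ → ℝ} (ht : Monotone t) {α : ℤ → ℝ}
    (hfin : (Function.support α).Finite) (i : ℤ) (k : ℕ) :
    ∃ p : Polynomial ℝ, p.natDegree ≤ k ∧
      ∀ x ∈ Set.Ico (t i) (t (i + 1)), ∑ᶠ j, α j * Bspline t (k + 1) j x = p.eval x := by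
  choose p hp hp' using Bspline_eqOn_polynomial ht i k
  refine ⟨∑ j ∈ hfin.toFinset, Polynomial.C (α j) * p j, ?_, fun x hx => ?_⟩
  · exact Polynomial.natDegree_sum_le_of_forall_le _ _
      fun j _ => (Polynomial.natDegree_C_mul_le _ _).trans (hp j)
  · rw [finsum_eq_sum_of_support_subset (s := hfin.toFinset), Polynomial.eval_finsetSum]
    · exact Finset.sum_congr rfl fun j _ => by simp [hp' j x hx]
    · intro j hj
      have := left_ne_zero_of_mul hj
      simpa using this

/-- A quadratic that is nonnegative on the positive reals has nonnegative constant coefficient, and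
its linear coefficient is nonnegative unless its discriminant is nonpositive. -/
theorem quadratic_nonneg_on_pos {A B C : ℝ} (hA : 0 ≤ A)
    (h : ∀ x, 0 < x → 0 ≤ A * x ^ 2 + B * x + C) : 0 ≤ C ∧ (B < 0 → B ^ 2 ≤ 4 * A * C) := by
  have hC : 0 ≤ C := by
    have hcl : IsClosed {x : ℝ | 0 ≤ A * x ^ 2 + B * x + C} :=
      isClosed_le continuous_const (by fun_prop)
    have hsub : closure (Set.Ioi (0 : ℝ)) ⊆ {x : ℝ | 0 ≤ A * x ^ 2 + B * x + C} :=
      hcl.closure_subset_iff.2 h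
    rw [closure_Ioi] at hsub
    simpa using hsub (Set.self_mem_Ici (a := (0 : ℝ)))
  refine ⟨hC, fun hB => ?_⟩
  rcases hA.eq_or_lt with rfl | hA
  · have hx : 0 < (C + 1) / -B := div_pos (by linarith) (by linarith)
    have h1 := h _ hx
    have h2 : B * ((C + 1) / -B) = -(C + 1) := by field_simp [hB.ne]
    linarith
  · have h1 := h (-B / (2 * A)) (div_pos (by linarith) (by linarith))
    have h2 : A * (-B / (2 * A)) ^ 2 + B * (-B / (2 * A)) + C = (4 * A * C - B ^ 2) / (4 * A) := by
      field_simp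
      ring
    rw [h2, le_div_iff₀ (by linarith)] at h1
    linarith

/-- Markov–Lukacs for cubics on the half-line, in coefficient form. -/
theorem cubic_nonneg_on_pos_decomposition {A B C D : ℝ} (hA : 0 ≤ A) (hD : 0 ≤ D)
    (h : ∀ x, 0 < x → 0 ≤ A * x ^ 3 + B * x ^ 2 + C * x + D) :
    ∃ b c e f : ℝ, 0 ≤ c ∧ 0 ≤ f ∧ b ^ 2 ≤ A * c ∧ e ^ 2 ≤ D * f ∧
      2 * b + f = B ∧ c + 2 * e = C := by
  rcases hD.eq_or_lt with rfl | hD'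
  · obtain ⟨hC, hB⟩ := quadratic_nonneg_on_pos (B := B) (C := C) hA fun x hx => by
      refine nonneg_of_mul_nonneg_right ?_ hx
      linarith [h x hx]
    rcases lt_or_ge B 0 with hB0 | hB0
    · exact ⟨B / 2, C, 0, 0, hC, le_rfl, by linarith [hB hB0], by simp, by ring, by ring⟩
    · exact ⟨0, C, 0, B, hC, hB0, by simpa using mul_nonneg hA hC, by simp, by ring, by ring⟩
  rcases hA.eq_or_lt with rfl | hA'
  · obtain ⟨hB, hC⟩ := quadratic_nonneg_on_pos (A := D) (B := C) (C := B) hD fun x hx => by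
      have h1 := h x⁻¹ (inv_pos.2 hx)
      have h2 : D * x ^ 2 + C * x + B
          = x ^ 2 * (0 * x⁻¹ ^ 3 + B * x⁻¹ ^ 2 + C * x⁻¹ + D) := by
        field_simp
        ring
      rw [h2]
      positivity
    rcases lt_or_ge C 0 with hC0 | hC0
    · exact ⟨0, 0, C / 2, B, le_rfl, hB, by simp, by linarith [hC hC0], by ring, by ring⟩
    · exact ⟨0, C, 0, B, hC0, hB, by simp, by simpa using mul_nonneg hD hB, by ring, by ring⟩
  -- `r` is a critical point of `x ↦ (A x³ + B x² + C x + D) / x`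
  obtain ⟨r, hr, hr0⟩ : ∃ r, 0 < r ∧ 2 * A * r ^ 3 + B * r ^ 2 = D := by
    set s := (|B| + D) / A + 1 with hs
    have hsA : A * s = |B| + D + A := by
      rw [hs]
      field_simp
    have hs1 : 1 ≤ s := by
      have : 0 ≤ (|B| + D) / A := by positivity
      linarith
    have hmem : D ∈ Set.Icc (2 * A * (0 : ℝ) ^ 3 + B * 0 ^ 2) (2 * A * s ^ 3 + B * s ^ 2) := by
      refine ⟨by simpa using hD, ?_⟩
      have h1 : D ≤ 2 * A * s + B := by nlinarith [neg_abs_le B, abs_nonneg B]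
      have h2 : 1 ≤ s ^ 2 := one_le_pow₀ hs1
      nlinarith
    obtain ⟨r, hr, hr'⟩ := intermediate_value_Icc (f := fun x => 2 * A * x ^ 3 + B * x ^ 2)
      (by linarith : (0 : ℝ) ≤ s) (by fun_prop) hmem
    refine ⟨r, hr.1.lt_of_ne ?_, hr'⟩
    rintro rfl
    simp only [ne_eq, OfNat.ofNat_ne_zero, not_false_eq_true, zero_pow, mul_zero, add_zero] at hr'
    exact hD'.ne hr'
  refine ⟨-A * r, C + 2 * (D / r), -(D / r), D / r ^ 2, ?_, by positivity, ?_, ?_, ?_, by ring⟩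
  all_goals
    have key : A * r ^ 2 ≤ C + 2 * (D / r) := by
      have h1 : C + 2 * (D / r) - A * r ^ 2 = (A * r ^ 3 + B * r ^ 2 + C * r + D) / r := by
        field_simp
        linear_combination -hr0
      have h2 := div_nonneg (h r hr) hr.le
      linarith
  · exact le_trans (by positivity) key
  · calc (-A * r) ^ 2 = A * (A * r ^ 2) := by ring
      _ ≤ _ := by gcongr
  · apply le_of_eq
    field_simp
  · field_simp
    linear_combination -hr0

theorem psd_form_nonneg {A B C : ℝ} (hA : 0 ≤ A) (hC : 0 ≤ C) (h : B ^ 2 ≤ A * C) (u v : ℝ) :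
    0 ≤ A * u ^ 2 + 2 * B * (u * v) + C * v ^ 2 := by
  rcases hA.eq_or_lt with rfl | hA
  · obtain rfl : B = 0 := by nlinarith
    simp only [zero_mul, mul_zero, zero_add]
    positivity
  · refine nonneg_of_mul_nonneg_right ?_ hA
    have : 0 ≤ (A * C - B ^ 2) * v ^ 2 := mul_nonneg (by linarith) (sq_nonneg v)
    nlinarith [sq_nonneg (A * u + B * v)]

theorem psd_quadratic_nonneg {p q r : ℝ} (hp : 0 ≤ p) (hr : 0 ≤ r) (h : q ^ 2 ≤ p * r) (x : ℝ) :
    0 ≤ p * x ^ 2 + 2 * q * x + r := by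
  simpa using psd_form_nonneg hp hr h x 1

/-- A positive semidefinite binary quadratic form, evaluated along an affine line, is a quadratic
with positive semidefinite coefficient matrix. -/
theorem exists_psd_coeffs_of_affine {A B C : ℝ} (hA : 0 ≤ A) (hC : 0 ≤ C) (h : B ^ 2 ≤ A * C)
    (a b : ℝ) : ∃ p q r : ℝ, 0 ≤ p ∧ 0 ≤ r ∧ q ^ 2 ≤ p * r ∧
      ∀ x, A * (x - a) ^ 2 + 2 * B * ((x - a) * (b - x)) + C * (b - x) ^ 2
        = p * x ^ 2 + 2 * q * x + r := by
  have nonneg := psd_form_nonneg hA hC h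
  refine ⟨A - 2 * B + C, -A * a + B * (a + b) - C * b, A * a ^ 2 - 2 * B * a * b + C * b ^ 2,
    ?_, ?_, ?_, fun x => by ring⟩
  · linarith [nonneg 1 (-1)]
  · linarith [nonneg (-a) b]
  · nlinarith [mul_nonneg (sub_nonneg.2 h) (sq_nonneg (b - a))]

/-- Markov–Lukacs for cubics on a compact interval. -/
theorem cubic_nonneg_on_Ico_decomposition {p : Polynomial ℝ} (hp : p.natDegree ≤ 3) {a b : ℝ}
    (hab : a < b) (h : ∀ x ∈ Set.Ico a b, 0 ≤ p.eval x) :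
    ∃ c₁₁ c₁₂ c₂₂ d₁₁ d₁₂ d₂₂ : ℝ,
      0 ≤ c₁₁ ∧ 0 ≤ c₂₂ ∧ 0 ≤ d₁₁ ∧ 0 ≤ d₂₂ ∧ c₁₂ ^ 2 ≤ c₁₁ * c₂₂ ∧ d₁₂ ^ 2 ≤ d₁₁ * d₂₂ ∧
      ∀ x, p.eval x = (x - a) * (c₁₁ * x ^ 2 + 2 * c₁₂ * x + c₂₂)
        + (b - x) * (d₁₁ * x ^ 2 + 2 * d₁₂ * x + d₂₂) := by
  have hw : 0 < b - a := sub_pos.2 hab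
  have hb : 0 ≤ p.eval b := by
    have hcl : IsClosed {x : ℝ | 0 ≤ p.eval x} := isClosed_le continuous_const p.continuous
    have hsub := hcl.closure_subset_iff.2 h
    rw [closure_Ico hab.ne] at hsub
    exact hsub (Set.right_mem_Icc.2 hab.le)
  have ha : 0 ≤ p.eval a := h a (Set.left_mem_Ico.2 hab)
  have heval : ∀ x, p.eval x
      = p.coeff 0 + p.coeff 1 * x + p.coeff 2 * x ^ 2 + p.coeff 3 * x ^ 3 := by
    intro x
    rw [Polynomial.eval_eq_sum_range' (show p.natDegree < 4 by lia)]
    simp [Finset.sum_range_succ]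
  generalize p.coeff 0 = e₀, p.coeff 1 = e₁, p.coeff 2 = e₂, p.coeff 3 = e₃ at heval
  obtain ⟨B, C, E, F, hC, hF, hBC, hEF, hq₂, hq₁⟩ := cubic_nonneg_on_pos_decomposition
    (B := 3 * e₀ + e₁ * (a + 2 * b) + e₂ * (b ^ 2 + 2 * a * b) + 3 * e₃ * a * b ^ 2)
    (C := 3 * e₀ + e₁ * (2 * a + b) + e₂ * (a ^ 2 + 2 * a * b) + 3 * e₃ * a ^ 2 * b)
    hb ha fun r hr => by
      have hr1 : 0 < 1 + r := by linarith
      have hmem : (a + b * r) / (1 + r) ∈ Set.Ico a b := by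
        constructor
        · rw [le_div_iff₀ hr1]
          nlinarith
        · rw [div_lt_iff₀ hr1]
          nlinarith
      have h1 := mul_nonneg (h _ hmem) (pow_pos hr1 3).le
      refine h1.trans_eq ?_
      simp only [heval]
      field_simp
      ring
  obtain ⟨c₁₁, c₁₂, c₂₂, hc₁, hc₂, hc, hcx⟩ := exists_psd_coeffs_of_affine hb hC hBC a b
  obtain ⟨d₁₁, d₁₂, d₂₂, hd₁, hd₂, hd, hdx⟩ :=
    exists_psd_coeffs_of_affine hF ha (by linarith : E ^ 2 ≤ F * p.eval a) a b
  set s := ((b - a) ^ 3)⁻¹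
  have hs0 : 0 ≤ s := by positivity
  have hsw : s * (b - a) ^ 3 = 1 := inv_mul_cancel₀ (pow_pos hw 3).ne'
  refine ⟨s * c₁₁, s * c₁₂, s * c₂₂, s * d₁₁, s * d₁₂, s * d₂₂, by positivity, by positivity,
    by positivity, by positivity, ?_, ?_, fun x => ?_⟩
  · calc (s * c₁₂) ^ 2 = s ^ 2 * c₁₂ ^ 2 := by ring
      _ ≤ s ^ 2 * (c₁₁ * c₂₂) := by gcongr
      _ = _ := by ring
  · calc (s * d₁₂) ^ 2 = s ^ 2 * d₁₂ ^ 2 := by ring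
      _ ≤ s ^ 2 * (d₁₁ * d₂₂) := by gcongr
      _ = _ := by ring
  · have expand : (b - a) ^ 3 * p.eval x
        = (x - a) * (c₁₁ * x ^ 2 + 2 * c₁₂ * x + c₂₂)
          + (b - x) * (d₁₁ * x ^ 2 + 2 * d₁₂ * x + d₂₂) := by
      rw [← hcx, ← hdx]
      obtain rfl := eq_sub_of_add_eq' hq₂
      obtain rfl := eq_sub_of_add_eq hq₁
      simp only [heval]
      ring
    linear_combination s * expand - p.eval x * hsw

theorem exists_knot_interval {t : ℤ → ℝ} {x : ℝ} (n : ℕ) (hx : x ∈ Set.Ico (t 1) (t (n + 1 : ℕ))) :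
    ∃ i : ℤ, 1 ≤ i ∧ i ≤ n ∧ x ∈ Set.Ico (t i) (t (i + 1)) := by
  induction n with
  | zero => exact absurd (hx.1.trans_lt hx.2) (by simp)
  | succ n ih =>
    rcases lt_or_ge x (t (n + 1 : ℕ)) with h | h
    · obtain ⟨i, h1, h2, h3⟩ := ih ⟨hx.1, h⟩
      exact ⟨i, h1, by push_cast; lia, h3⟩
    · exact ⟨(n + 1 : ℕ), by push_cast; lia, le_rfl, h, by simpa using hx.2⟩


/-- Global nonnegativity characterization for cubic (order-4) B-splines: the spline
`Σⱼ αⱼ B_{j,4}` is nonnegative on `[t₁, t_{n+1})` iff on every nondegenerate knot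
interval `[tᵢ, t_{i+1})`, `i ∈ {1, …, n}`, it admits a Markov–Lukacs representation with
second-order-cone constrained coefficients. -/
theorem bspline4_nonneg_global_iff (t : ℤ → ℝ) (ht : Monotone t) (α : ℤ → ℝ)
    (hfin : (Function.support α).Finite) (n : ℕ) (hn : 1 ≤ n) :
    (∀ x ∈ Set.Ico (t 1) (t (n + 1 : ℕ)), 0 ≤ ∑ᶠ j, α j * Bspline t 4 j x) ↔
      ∀ i : ℤ, 1 ≤ i → i ≤ (n : ℤ) → t i < t (i + 1) →
        ∃ c₁₁ c₁₂ c₂₂ d₁₁ d₁₂ d₂₂ : ℝ,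
          0 ≤ c₁₁ ∧ 0 ≤ c₂₂ ∧ 0 ≤ d₁₁ ∧ 0 ≤ d₂₂ ∧
          c₁₂ ^ 2 ≤ c₁₁ * c₂₂ ∧ d₁₂ ^ 2 ≤ d₁₁ * d₂₂ ∧
          ∀ x ∈ Set.Ico (t i) (t (i + 1)),
            (∑ᶠ j, α j * Bspline t 4 j x) =
              (x - t i) * (c₁₁ * x ^ 2 + 2 * c₁₂ * x + c₂₂)
                + (t (i + 1) - x) * (d₁₁ * x ^ 2 + 2 * d₁₂ * x + d₂₂) := by
  constructor
  · intro h i h1 hin hlt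
    obtain ⟨p, hp, hpx⟩ := finsum_mul_Bspline_eqOn_polynomial ht hfin i 3
    obtain ⟨c₁₁, c₁₂, c₂₂, d₁₁, d₁₂, d₂₂, hc₁, hc₂, hd₁, hd₂, hc, hd, hx⟩ :=
      cubic_nonneg_on_Ico_decomposition hp hlt fun x hx => by
        rw [← hpx x hx]
        exact h x ⟨(ht h1).trans hx.1, hx.2.trans_le (ht (by push_cast; lia))⟩
    exact ⟨c₁₁, c₁₂, c₂₂, d₁₁, d₁₂, d₂₂, hc₁, hc₂, hd₁, hd₂, hc, hd,
      fun x hmem => (hpx x hmem).trans (hx x)⟩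
  · intro h x hx
    obtain ⟨i, h1, hin, hmem⟩ := exists_knot_interval n hx
    obtain ⟨c₁₁, c₁₂, c₂₂, d₁₁, d₁₂, d₂₂, hc₁, hc₂, hd₁, hd₂, hc, hd, hrep⟩ :=
      h i h1 hin (hmem.1.trans_lt hmem.2)
    rw [hrep x hmem]
    exact add_nonneg
      (mul_nonneg (sub_nonneg.2 hmem.1) (psd_quadratic_nonneg hc₁ hc₂ hc x))
      (mul_nonneg (sub_nonneg.2 hmem.2.le) (psd_quadratic_nonneg hd₁ hd₂ hd x))
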